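/- arXiv:1708.03609 — 3 statements merged into one kernel-verified Lean document; each statement's English description precedes it below -/
import Mathlib

section
/- Let G be a 2-connected graph with distinguished vertices X = {a,b,c,d}, and suppose G is a spanning subgraph of H⁺ for one of the following graphs H: (Class 𝒜) V(H) = {a,b,c,d,e}, E(H) = {ae, ad, be, bd, ce, cd, de}; (Class ℬ) V(H) = {a,b,c,d,e,f}, E(H) = {ae, af, be, bf, ce, cf, de, df, ef}; (Class 𝒞) V(H) = {a,b,c,d,e,f,g}, E(H) = {ae, ag, be, bg, cf, cg, df, dg, ef, eg, fg}. Then G has no W4(X)-minor. -/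
namespace Paper

open SimpleGraph

variable {V : Type*} {U : Type*}

/-- An `H`-model in `G`: pairwise vertex-disjoint connected branch sets indexed by the
vertices of `H`, with an edge of `G` between the branch sets of any two vertices
adjacent in `H`. -/
structure IsModel (G : SimpleGraph V) {W : Type*} (H : SimpleGraph W) (B : W → Set V) :
    Prop where
  connected : ∀ x : W, (G.induce (B x)).Connected
  disjoint : ∀ x y : W, x ≠ y → Disjoint (B x) (B y)
  adj_of_adj : ∀ ⦃x y : W⦄, H.Adj x y → ∃ u ∈ B x, ∃ v ∈ B y, G.Adj u v

/-- `G` is `k`-connected: it has more than `k` vertices, and deleting any set of fewer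
than `k` vertices leaves a connected graph. -/
def KConnected (G : SimpleGraph V) [Fintype V] (k : ℕ) : Prop :=
  k < Fintype.card V ∧ ∀ S : Set V, S.ncard < k → (G.induce Sᶜ).Connected

/-- A separation of `G`: a pair of vertex sets covering `V(G)` with no edge of `G`
between `A \ B` and `B \ A`. -/
def IsSeparation (G : SimpleGraph V) (A B : Set V) : Prop :=
  A ∪ B = Set.univ ∧ ∀ u v : V, u ∈ A \ B → v ∈ B \ A → ¬ G.Adj u v

/-- `Wb` is `H⁺` for the graph `H`, whose vertices sit inside the vertex set of `Wb`
via the embedding `g`: every vertex outside the image of `g` is assigned a triangle of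
`H`; the vertices assigned to a common triangle `T` form a clique completely joined to
`T`, and there are no other edges besides those of `H`. -/
def IsPlusOf (Wb : SimpleGraph V) (H : SimpleGraph U) (g : U ↪ V) : Prop :=
  ∃ t : V → Set U,
    (∀ v : V, v ∉ Set.range g →
      ∃ x y z : U, x ≠ y ∧ x ≠ z ∧ y ≠ z ∧ H.Adj x y ∧ H.Adj x z ∧ H.Adj y z ∧
        t v = {x, y, z}) ∧
    (∀ u u' : U, Wb.Adj (g u) (g u') ↔ H.Adj u u') ∧
    (∀ v v' : V, v ∉ Set.range g → v' ∉ Set.range g →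
      (Wb.Adj v v' ↔ (v ≠ v' ∧ t v = t v'))) ∧
    (∀ v : V, v ∉ Set.range g → ∀ u : U, (Wb.Adj v (g u) ↔ u ∈ t v))

/-- The wheel `W₄`: the 4-cycle `0-1-2-3-0` together with the hub `4`. -/
def W4 : SimpleGraph (Fin 5) := SimpleGraph.fromRel (fun i j =>
  (i, j) ∈ ([(0, 1), (1, 2), (2, 3), (3, 0), (4, 0), (4, 1), (4, 2), (4, 3)] :
    List (Fin 5 × Fin 5)))

/-- `G` has a `K₄(X)`-minor for `X = {a,b,c,d}`: a `K₄`-model of `G` in which the four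
roots lie in four distinct branch sets. -/
def HasK4XMinor (G : SimpleGraph V) (a b c d : V) : Prop :=
  ∃ (B : Fin 4 → Set V) (f : Fin 4 → Fin 4), Function.Injective f ∧
    IsModel G (⊤ : SimpleGraph (Fin 4)) B ∧
    a ∈ B (f 0) ∧ b ∈ B (f 1) ∧ c ∈ B (f 2) ∧ d ∈ B (f 3)

/-- `G` has a `W₄(X)`-minor for `X = {a,b,c,d}`: a `W₄`-model of `G` in which the four
roots lie in four distinct branch sets of rim (4-cycle) vertices. -/
def HasW4XMinor (G : SimpleGraph V) (a b c d : V) : Prop :=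
  ∃ (B : Fin 5 → Set V) (f : Fin 4 → Fin 5), Function.Injective f ∧ (∀ i, f i ≠ 4) ∧
    IsModel G W4 B ∧
    a ∈ B (f 0) ∧ b ∈ B (f 1) ∧ c ∈ B (f 2) ∧ d ∈ B (f 3)

/-- The class 𝒜 core graph: vertices `a,b,c,d,e = 0,1,2,3,4`,
edges `ae, ad, be, bd, ce, cd, de`. -/
def classA : SimpleGraph (Fin 5) := SimpleGraph.fromRel (fun i j =>
  (i, j) ∈ ([(0, 4), (0, 3), (1, 4), (1, 3), (2, 4), (2, 3), (3, 4)] :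
    List (Fin 5 × Fin 5)))

/-- The class ℬ core graph: vertices `a,b,c,d,e,f = 0,1,2,3,4,5`,
edges `ae, af, be, bf, ce, cf, de, df, ef`. -/
def classB : SimpleGraph (Fin 6) := SimpleGraph.fromRel (fun i j =>
  (i, j) ∈ ([(0, 4), (0, 5), (1, 4), (1, 5), (2, 4), (2, 5), (3, 4), (3, 5), (4, 5)] :
    List (Fin 6 × Fin 6)))

/-- The class 𝒞 core graph: vertices `a,b,c,d,e,f,g = 0,1,2,3,4,5,6`,
edges `ae, ag, be, bg, cf, cg, df, dg, ef, eg, fg`. -/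
def classC : SimpleGraph (Fin 7) := SimpleGraph.fromRel (fun i j =>
  (i, j) ∈ ([(0, 4), (0, 6), (1, 4), (1, 6), (2, 5), (2, 6), (3, 5), (3, 6), (4, 5),
             (4, 6), (5, 6)] : List (Fin 7 × Fin 7)))

/-- In `W₄`, two vertices avoiding a given pair `P, Q` are equal, adjacent, or have a common
neighbour avoiding `P, Q`. -/
theorem W4_eq_or_adj_or_common_neighbor :
    ∀ P Q i j : Fin 5, i ≠ P → i ≠ Q → j ≠ P → j ≠ Q →
      i = j ∨ W4.Adj i j ∨ ∃ k, k ≠ P ∧ k ≠ Q ∧ W4.Adj i k ∧ W4.Adj k j := by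
  let _ : DecidableRel W4.Adj := fun i j => decidable_of_iff _ (SimpleGraph.fromRel_adj _ i j).symm
  decide

/-- A connected induced subgraph avoiding `p, q` which meets a set `C` closed under adjacency
in `G - {p, q}` is contained in `C`. -/
theorem subset_of_connected {G : SimpleGraph V} {C S : Set V} {p q : V}
    (hC : ∀ v w, v ∈ C → G.Adj v w → w = p ∨ w = q ∨ w ∈ C)
    (hS : (G.induce S).Connected) (hp : p ∉ S) (hq : q ∉ S) {x : V} (hxS : x ∈ S)
    (hxC : x ∈ C) : S ⊆ C := by
  intro y hy
  obtain ⟨w⟩ := hS.preconnected ⟨x, hxS⟩ ⟨y, hy⟩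
  have walk_mem : ∀ u v : S, (G.induce S).Walk u v → (u : V) ∈ C → (v : V) ∈ C := by
    intro u v w
    induction w with
    | nil => exact id
    | @cons u v _ h _ ih =>
      intro hu
      refine ih ?_
      rcases hC u v hu h with h1 | h1 | h1
      · exact absurd (h1 ▸ v.2) hp
      · exact absurd (h1 ▸ v.2) hq
      · exact h1
  exact walk_mem _ _ w hxC

/-- A vertex `p` outside the branch sets of `i` and `j` lies in at most one branch set of a
`W₄`-model, whose index can be taken different from `i` and `j`. -/
theorem IsModel.exists_index {G : SimpleGraph V} {B : Fin 5 → Set V} (hB : IsModel G W4 B)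
    {p : V} {i j : Fin 5} (hi : p ∉ B i) (hj : p ∉ B j) :
    ∃ P, i ≠ P ∧ j ≠ P ∧ ∀ k, k ≠ P → p ∉ B k := by
  by_cases h : ∃ P, p ∈ B P
  · obtain ⟨P, hP⟩ := h
    exact ⟨P, fun e => hi (e ▸ hP), fun e => hj (e ▸ hP),
      fun k hk hpk => Set.disjoint_left.1 (hB.disjoint k P hk) hpk hP⟩
  · have hP : ∀ i j : Fin 5, ∃ P, i ≠ P ∧ j ≠ P := by decide
    obtain ⟨P, hiP, hjP⟩ := hP i j
    exact ⟨P, hiP, hjP, fun k _ hpk => h ⟨k, hpk⟩⟩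

/-- Two branch sets of a `W₄`-model avoiding `p, q` lie in the same union of components of
`G - {p, q}`. -/
theorem IsModel.mem_of_W4 {G : SimpleGraph V} {B : Fin 5 → Set V} (hB : IsModel G W4 B)
    {C : Set V} {p q : V}
    (hC : ∀ v w, v ∈ C → G.Adj v w → w = p ∨ w = q ∨ w ∈ C) {i j : Fin 5}
    (hpi : p ∉ B i) (hqi : q ∉ B i) (hpj : p ∉ B j) (hqj : q ∉ B j) {x y : V}
    (hx : x ∈ B i) (hy : y ∈ B j) (hxC : x ∈ C) : y ∈ C := by
  have step : ∀ k l : Fin 5, W4.Adj k l → p ∉ B l → q ∉ B l → B k ⊆ C → B l ⊆ C := by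
    intro k l hkl hp hq hk
    obtain ⟨u, hu, v, hv, huv⟩ := hB.adj_of_adj hkl
    refine subset_of_connected hC (hB.connected l) hp hq hv ?_
    rcases hC u v (hk hu) huv with h | h | h
    · exact absurd (h ▸ hv) hp
    · exact absurd (h ▸ hv) hq
    · exact h
  have hi : B i ⊆ C := subset_of_connected hC (hB.connected i) hpi hqi hx hxC
  obtain ⟨P, hPi, hPj, hP⟩ := hB.exists_index hpi hpj
  obtain ⟨Q, hQi, hQj, hQ⟩ := hB.exists_index hqi hqj
  rcases W4_eq_or_adj_or_common_neighbor P Q i j hPi hQi hPj hQj with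
    rfl | h | ⟨k, hkP, hkQ, hik, hkj⟩
  · exact hi hy
  · exact step i j h hpj hqj hi hy
  · exact step k j hkj hpj hqj (step i k hik (hP k hkP) (hQ k hkQ) hi) hy

/-- If `i` is adjacent in `H` only to `p` and `q`, then `g i` together with the cliques
attached to triangles through `i` is separated from the rest of `H⁺` by `g p` and `g q`. -/
theorem IsPlusOf.exists_closed {Wb : SimpleGraph V} {H : SimpleGraph U} {g : U ↪ V}
    (h : IsPlusOf Wb H g) {i p q : U} (hi : ∀ j, H.Adj i j → j = p ∨ j = q) :
    ∃ C : Set V, g i ∈ C ∧ (∀ j, g j ∈ C → j = i) ∧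
      ∀ v w, v ∈ C → Wb.Adj v w → w = g p ∨ w = g q ∨ w ∈ C := by
  obtain ⟨t, ht, hcore, hout, hmix⟩ := h
  have mem_t : ∀ v, v ∉ Set.range g → i ∈ t v → ∀ j ∈ t v, j = i ∨ H.Adj i j := by
    intro v hv hiv j hj
    obtain ⟨x, y, z, -, -, -, hxy, hxz, hyz, he⟩ := ht v hv
    rw [he] at hiv hj
    simp only [Set.mem_insert_iff, Set.mem_singleton_iff] at hiv hj
    have := hxy.symm
    have := hxz.symm
    have := hyz.symm
    rcases hiv with rfl | rfl | rfl <;> rcases hj with rfl | rfl | rfl <;> simp [*]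
  refine ⟨{v | v = g i ∨ (v ∉ Set.range g ∧ i ∈ t v)}, Or.inl rfl, ?_, ?_⟩
  · rintro j (hj | hj)
    · exact g.injective hj
    · exact absurd ⟨j, rfl⟩ hj.1
  · rintro v w hv hvw
    by_cases hw : w ∈ Set.range g
    · obtain ⟨j, rfl⟩ := hw
      have hj : j = i ∨ H.Adj i j := by
        rcases hv with rfl | ⟨hv, hiv⟩
        · exact Or.inr ((hcore _ _).1 hvw)
        · exact mem_t v hv hiv j ((hmix v hv j).1 hvw)
      rcases hj with rfl | hj
      · exact Or.inr (Or.inr (Or.inl rfl))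
      · rcases hi j hj with rfl | rfl
        · exact Or.inl rfl
        · exact Or.inr (Or.inl rfl)
    · refine Or.inr (Or.inr (Or.inr ⟨hw, ?_⟩))
      rcases hv with rfl | ⟨hv, hiv⟩
      · exact (hmix w hw i).1 hvw.symm
      · exact ((hout v w hv hw).1 hvw).2 ▸ hiv

/-- If `i` is adjacent in `H` only to `p` and `q`, then of the branch sets of `g i` and `g j`
in a `W₄`-model one must contain `g p` or `g q`. -/
theorem IsPlusOf.mem_branch_of_W4 {G Wb : SimpleGraph V} {H : SimpleGraph U} {g : U ↪ V}
    (h : IsPlusOf Wb H g) (hG : G ≤ Wb) {B : Fin 5 → Set V} (hB : IsModel G W4 B)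
    {i j p q : U} (hi : ∀ j, H.Adj i j → j = p ∨ j = q) (hij : j ≠ i) {k l : Fin 5}
    (hk : g i ∈ B k) (hl : g j ∈ B l) :
    g p ∈ B k ∨ g q ∈ B k ∨ g p ∈ B l ∨ g q ∈ B l := by
  by_contra! hcon
  obtain ⟨C, hiC, hjC, hC⟩ := h.exists_closed hi
  exact hij (hjC j (hB.mem_of_W4 (fun v w hv hvw => hC v w hv (hG hvw)) hcon.1 hcon.2.1
    hcon.2.2.1 hcon.2.2.2 hk hl hiC))

/-- A 2-connected spanning subgraph of `H⁺` for a class 𝒜, ℬ or 𝒞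
graph `H` (with distinguished vertices `a,b,c,d`) has no `W₄(X)`-minor. -/
theorem classABC_no_W4X
    {V : Type*} [Fintype V] (G : SimpleGraph V) (hG2 : KConnected G 2)
    (a b c d : V)
    (hclass :
      (∃ (Wb : SimpleGraph V) (g : Fin 5 ↪ V), g 0 = a ∧ g 1 = b ∧ g 2 = c ∧ g 3 = d ∧
        IsPlusOf Wb classA g ∧ G ≤ Wb) ∨
      (∃ (Wb : SimpleGraph V) (g : Fin 6 ↪ V), g 0 = a ∧ g 1 = b ∧ g 2 = c ∧ g 3 = d ∧
        IsPlusOf Wb classB g ∧ G ≤ Wb) ∨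
      (∃ (Wb : SimpleGraph V) (g : Fin 7 ↪ V), g 0 = a ∧ g 1 = b ∧ g 2 = c ∧ g 3 = d ∧
        IsPlusOf Wb classC g ∧ G ≤ Wb)) :
    ¬ HasW4XMinor G a b c d := by
  rintro ⟨B, f, hf, -, hB, ha, hb, hc, hd⟩
  have uniq : ∀ i j : Fin 4, i ≠ j → ∀ v, v ∈ B (f i) → v ∉ B (f j) := fun i j hij v hi hj =>
    Set.disjoint_left.1 (hB.disjoint _ _ (hf.ne hij)) hi hj
  have u01 := uniq 0 1 (by decide)
  have u02 := uniq 0 2 (by decide)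
  have u03 := uniq 0 3 (by decide)
  have u12 := uniq 1 2 (by decide)
  have u13 := uniq 1 3 (by decide)
  have u23 := uniq 2 3 (by decide)
  rcases hclass with ⟨Wb, g, rfl, rfl, rfl, rfl, hW, hG⟩ | ⟨Wb, g, rfl, rfl, rfl, rfl, hW, hG⟩ |
    ⟨Wb, g, rfl, rfl, rfl, rfl, hW, hG⟩
  · have n0 : ∀ j, classA.Adj 0 j → j = 3 ∨ j = 4 := by
      simp only [classA, SimpleGraph.fromRel_adj]; decide
    have n1 : ∀ j, classA.Adj 1 j → j = 3 ∨ j = 4 := by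
      simp only [classA, SimpleGraph.fromRel_adj]; decide
    have h01 := hW.mem_branch_of_W4 hG hB n0 (by decide) ha hb
    have h02 := hW.mem_branch_of_W4 hG hB n0 (by decide) ha hc
    have h12 := hW.mem_branch_of_W4 hG hB n1 (by decide) hb hc
    grind
  · have n0 : ∀ j, classB.Adj 0 j → j = 4 ∨ j = 5 := by
      simp only [classB, SimpleGraph.fromRel_adj]; decide
    have n1 : ∀ j, classB.Adj 1 j → j = 4 ∨ j = 5 := by
      simp only [classB, SimpleGraph.fromRel_adj]; decide
    have n2 : ∀ j, classB.Adj 2 j → j = 4 ∨ j = 5 := by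
      simp only [classB, SimpleGraph.fromRel_adj]; decide
    have h01 := hW.mem_branch_of_W4 hG hB n0 (by decide) ha hb
    have h02 := hW.mem_branch_of_W4 hG hB n0 (by decide) ha hc
    have h03 := hW.mem_branch_of_W4 hG hB n0 (by decide) ha hd
    have h12 := hW.mem_branch_of_W4 hG hB n1 (by decide) hb hc
    have h13 := hW.mem_branch_of_W4 hG hB n1 (by decide) hb hd
    have h23 := hW.mem_branch_of_W4 hG hB n2 (by decide) hc hd
    grind
  · have n0 : ∀ j, classC.Adj 0 j → j = 4 ∨ j = 6 := by
      simp only [classC, SimpleGraph.fromRel_adj]; decide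
    have n1 : ∀ j, classC.Adj 1 j → j = 4 ∨ j = 6 := by
      simp only [classC, SimpleGraph.fromRel_adj]; decide
    have n2 : ∀ j, classC.Adj 2 j → j = 5 ∨ j = 6 := by
      simp only [classC, SimpleGraph.fromRel_adj]; decide
    have n3 : ∀ j, classC.Adj 3 j → j = 5 ∨ j = 6 := by
      simp only [classC, SimpleGraph.fromRel_adj]; decide
    have h01 := hW.mem_branch_of_W4 hG hB n0 (by decide) ha hb
    have h02 := hW.mem_branch_of_W4 hG hB n0 (by decide) ha hc
    have h03 := hW.mem_branch_of_W4 hG hB n0 (by decide) ha hd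
    have h12 := hW.mem_branch_of_W4 hG hB n1 (by decide) hb hc
    have h13 := hW.mem_branch_of_W4 hG hB n1 (by decide) hb hd
    have h20 := hW.mem_branch_of_W4 hG hB n2 (by decide) hc ha
    have h21 := hW.mem_branch_of_W4 hG hB n2 (by decide) hc hb
    have h23 := hW.mem_branch_of_W4 hG hB n2 (by decide) hc hd
    have h30 := hW.mem_branch_of_W4 hG hB n3 (by decide) hd ha
    have h31 := hW.mem_branch_of_W4 hG hB n3 (by decide) hd hb
    grind

end Paper
end

section
/- Let H be the graph with vertex set {t1, t2, s1, s2} and edge set {t1s1, t1s2, t2s1, t2s2, s1s2}, and let G be a 2-connected spanning subgraph of H⁺ (cliques attached to the triangles {t1,s1,s2} and {t2,s1,s2} of H). Take X = {t1, t2, s1, s2}. Then: (i) G has a K_{2,2}-model in which t1 and t2 lie in the two branch sets of one side of the bipartition (in either order) and s1 and s2 lie in the two branch sets of the other side (in either order); and (ii) G has no K_{2,4}(X)-minor. -/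
namespace Paper

open SimpleGraph

variable {V : Type*} {U : Type*}

/-- `G` has a `K_{2,2}`-model in which `t1` and `t2` lie in the two branch sets of one
side of the bipartition (in either order) and `s1` and `s2` lie in the two branch sets
of the other side (in either order). -/
def HasK22TSMinor (G : SimpleGraph V) (t1 t2 s1 s2 : V) : Prop :=
  ∃ B : (Fin 2 ⊕ Fin 2) → Set V,
    IsModel G (completeBipartiteGraph (Fin 2) (Fin 2)) B ∧
    ((((t1 ∈ B (.inl 0) ∧ t2 ∈ B (.inl 1)) ∨ (t1 ∈ B (.inl 1) ∧ t2 ∈ B (.inl 0))) ∧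
      ((s1 ∈ B (.inr 0) ∧ s2 ∈ B (.inr 1)) ∨ (s1 ∈ B (.inr 1) ∧ s2 ∈ B (.inr 0)))) ∨
     (((s1 ∈ B (.inl 0) ∧ s2 ∈ B (.inl 1)) ∨ (s1 ∈ B (.inl 1) ∧ s2 ∈ B (.inl 0))) ∧
      ((t1 ∈ B (.inr 0) ∧ t2 ∈ B (.inr 1)) ∨ (t1 ∈ B (.inr 1) ∧ t2 ∈ B (.inr 0)))))

/-- `G` has a `K_{2,4}(X)`-minor for `X = {a,b,c,d}`: a `K_{2,4}`-model of `G` in which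
the four roots lie in four distinct branch sets on the large side of the bipartition. -/
def HasK24XMinor (G : SimpleGraph V) (a b c d : V) : Prop :=
  ∃ (B : (Fin 2 ⊕ Fin 4) → Set V) (f : Fin 4 → Fin 4), Function.Injective f ∧
    IsModel G (completeBipartiteGraph (Fin 2) (Fin 4)) B ∧
    a ∈ B (.inr (f 0)) ∧ b ∈ B (.inr (f 1)) ∧ c ∈ B (.inr (f 2)) ∧ d ∈ B (.inr (f 3))

/-- The graph `H` with vertex set `{t1, t2, s1, s2} = {0, 1, 2, 3}` and edge set
`{t1s1, t1s2, t2s1, t2s2, s1s2}`. -/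
def Hts : SimpleGraph (Fin 4) := SimpleGraph.fromRel (fun i j =>
  (i, j) ∈ ([(0, 2), (0, 3), (1, 2), (1, 3), (2, 3)] : List (Fin 4 × Fin 4)))

/-- A property that is preserved along the edges inside a connected induced subgraph holds
throughout it as soon as it holds somewhere. -/
lemma of_connected_induce {G : SimpleGraph V} {B : Set V} (hB : (G.induce B).Connected)
    {P : V → Prop} (hP : ∀ u ∈ B, ∀ v ∈ B, G.Adj u v → P u → P v)
    {x y : V} (hx : x ∈ B) (hy : y ∈ B) (h : P x) : P y := by
  obtain ⟨w⟩ := hB.preconnected ⟨x, hx⟩ ⟨y, hy⟩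
  have key : ∀ {a b : B}, (G.induce B).Walk a b → P a → P b := by
    intro a b w
    induction w with
    | nil => exact id
    | cons hadj _ ih => exact fun ha => ih (hP _ (Subtype.prop _) _ (Subtype.prop _) hadj ha)
  exact key w h

/-- The set of vertices reachable from `a` in `G` by a walk none of whose later vertices
lies in `S`. -/
def reachAvoiding (G : SimpleGraph V) (S : Set V) (a : V) : Set V :=
  {v | Relation.ReflTransGen (fun x y => G.Adj x y ∧ y ∉ S) a v}

lemma self_mem_reachAvoiding (G : SimpleGraph V) (S : Set V) (a : V) :
    a ∈ reachAvoiding G S a :=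
  Relation.ReflTransGen.refl

lemma connected_induce_reachAvoiding (G : SimpleGraph V) (S : Set V) (a : V) :
    (G.induce (reachAvoiding G S a)).Connected := by
  have key : ∀ v (hv : v ∈ reachAvoiding G S a),
      (G.induce (reachAvoiding G S a)).Reachable ⟨a, self_mem_reachAvoiding G S a⟩ ⟨v, hv⟩ := by
    intro v hv
    induction hv with
    | refl => exact Reachable.refl _
    | tail hb hbc ih =>
      exact ih.trans (Adj.reachable (G := G.induce (reachAvoiding G S a))
        (u := ⟨_, hb⟩) (v := ⟨_, hb.tail hbc⟩) hbc.1)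
  have : Nonempty (reachAvoiding G S a) := ⟨⟨a, self_mem_reachAvoiding G S a⟩⟩
  exact Connected.mk fun u v => (key u u.2).symm.trans (key v v.2)

/-- `A` is a union of components of `G - S`, up to vertices of `S`. -/
def IsSideOf (G : SimpleGraph V) (S A : Set V) : Prop :=
  ∀ ⦃u v : V⦄, G.Adj u v → u ∉ S → v ∉ S → u ∈ A → v ∈ A

lemma IsSideOf.compl {G : SimpleGraph V} {S A : Set V} (h : IsSideOf G S A) :
    IsSideOf G S Aᶜ :=
  fun _ _ huv hu hv hA hA' => hA (h huv.symm hv hu hA')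

lemma not_mem_of_mem_reachAvoiding {G : SimpleGraph V} {S : Set V} {a v : V} (ha : a ∉ S)
    (hv : v ∈ reachAvoiding G S a) : v ∉ S := by
  induction hv with
  | refl => exact ha
  | tail _ hbc _ => exact hbc.2

lemma IsSideOf.reachAvoiding_subset {G : SimpleGraph V} {S A : Set V} (h : IsSideOf G S A)
    {a : V} (ha : a ∉ S) (haA : a ∈ A) : reachAvoiding G S a ⊆ A := by
  intro v hv
  induction hv with
  | refl => exact haA
  | tail hb hbc ih => exact h hbc.1 (not_mem_of_mem_reachAvoiding ha hb) hbc.2 ih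

/-- If `G - s'` is connected and `{s, s'}` separates `a` from `b`, then the component of
`a` in `G - {s, s'}` has a neighbour of `s`. -/
lemma IsSideOf.exists_adj {G : SimpleGraph V} {S A : Set V} {s s' a b : V}
    (h : IsSideOf G S A) (hS : ∀ v, v ∈ S ↔ v = s ∨ v = s')
    (hconn : (G.induce ({s'} : Set V)ᶜ).Connected)
    (ha : a ∉ S) (hb : b ∉ S) (haA : a ∈ A) (hbA : b ∉ A) :
    ∃ u ∈ reachAvoiding G S a, G.Adj u s := by
  by_contra! hno
  refine hbA (h.reachAvoiding_subset ha haA ?_)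
  refine of_connected_induce hconn (P := (· ∈ reachAvoiding G S a)) ?_ (x := a) ?_ ?_
    (self_mem_reachAvoiding G S a)
  · intro u _ v hv huv hu
    refine Relation.ReflTransGen.tail hu ⟨huv, fun hvS => ?_⟩
    rcases (hS v).1 hvS with rfl | rfl
    · exact hno u hu huv
    · exact hv rfl
  · exact fun h' => ha ((hS a).2 (Or.inr h'))
  · exact fun h' => hb ((hS b).2 (Or.inr h'))

lemma IsSideOf.hasK22TSMinor {G : SimpleGraph V} {A : Set V} {t1 t2 s1 s2 : V}
    (h : IsSideOf G {s1, s2} A) (hs : s1 ≠ s2)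
    (hconn : ∀ s, (G.induce ({s} : Set V)ᶜ).Connected)
    (ht1 : t1 ∉ ({s1, s2} : Set V)) (ht2 : t2 ∉ ({s1, s2} : Set V))
    (hA1 : t1 ∈ A) (hA2 : t2 ∉ A) : HasK22TSMinor G t1 t2 s1 s2 := by
  set K := reachAvoiding G {s1, s2} with hK
  have hadj1 : ∀ s, s = s1 ∨ s = s2 → ∃ u ∈ K t1, G.Adj u s := by
    rintro s (rfl | rfl)
    · exact h.exists_adj (fun v => Iff.rfl) (hconn s2) ht1 ht2 hA1 hA2
    · exact h.exists_adj (fun v => or_comm) (hconn s1) ht1 ht2 hA1 hA2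
  have hadj2 : ∀ s, s = s1 ∨ s = s2 → ∃ u ∈ K t2, G.Adj u s := by
    rintro s (rfl | rfl)
    · exact h.compl.exists_adj (fun v => Iff.rfl) (hconn s2) ht2 ht1 hA2 (fun h' => h' hA1)
    · exact h.compl.exists_adj (fun v => or_comm) (hconn s1) ht2 ht1 hA2 (fun h' => h' hA1)
  have hKK : Disjoint (K t1) (K t2) :=
    disjoint_compl_right.mono (h.reachAvoiding_subset ht1 hA1)
      (h.compl.reachAvoiding_subset ht2 hA2)
  have hKs : ∀ t, t ∉ ({s1, s2} : Set V) → ∀ s, s = s1 ∨ s = s2 → Disjoint (K t) {s} := by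
    intro t ht s hs'
    rw [Set.disjoint_singleton_right]
    exact fun hmem => not_mem_of_mem_reachAvoiding ht hmem hs'
  have hss : Disjoint ({s1} : Set V) {s2} := by simpa using hs
  have hsc : ∀ s : V, (G.induce ({s} : Set V)).Connected := by
    intro s
    have : Nonempty ({s} : Set V) := ⟨⟨s, rfl⟩⟩
    refine Connected.mk fun u v => ?_
    rw [Subsingleton.elim u v]
  refine ⟨Sum.elim ![K t1, K t2] ![{s1}, {s2}], ⟨?_, ?_, ?_⟩, Or.inl ⟨Or.inl ?_, Or.inl ?_⟩⟩
  · rintro (i | i) <;> fin_cases i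
    · exact connected_induce_reachAvoiding G _ t1
    · exact connected_induce_reachAvoiding G _ t2
    · exact hsc s1
    · exact hsc s2
  · have d11 := hKs t1 ht1 s1 (Or.inl rfl)
    have d12 := hKs t1 ht1 s2 (Or.inr rfl)
    have d21 := hKs t2 ht2 s1 (Or.inl rfl)
    have d22 := hKs t2 ht2 s2 (Or.inr rfl)
    rintro (i | i) (j | j) hij <;> fin_cases i <;> fin_cases j <;>
      first
      | exact absurd rfl hij
      | assumption
      | (apply Disjoint.symm; assumption)
  · have main : ∀ i j : Fin 2, ∃ u ∈ (![K t1, K t2] : Fin 2 → Set V) i,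
        ∃ v ∈ (![{s1}, {s2}] : Fin 2 → Set V) j, G.Adj u v := by
      intro i j
      have hj : ∃ s ∈ (![{s1}, {s2}] : Fin 2 → Set V) j, s = s1 ∨ s = s2 := by
        fin_cases j
        · exact ⟨s1, rfl, Or.inl rfl⟩
        · exact ⟨s2, rfl, Or.inr rfl⟩
      obtain ⟨s, hsj, hs'⟩ := hj
      have hi : ∃ u ∈ (![K t1, K t2] : Fin 2 → Set V) i, G.Adj u s := by
        fin_cases i
        · exact hadj1 s hs'
        · exact hadj2 s hs'
      obtain ⟨u, hu, hus⟩ := hi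
      exact ⟨u, hu, s, hsj, hus⟩
    rintro (i | i) (j | j) hij
    · simp at hij
    · exact main i j
    · obtain ⟨u, hu, v, hv, huv⟩ := main j i
      exact ⟨v, hv, u, hu, huv.symm⟩
    · simp at hij
  · exact ⟨self_mem_reachAvoiding G _ t1, self_mem_reachAvoiding G _ t2⟩
  · exact ⟨rfl, rfl⟩

lemma IsSideOf.not_hasK24XMinor {G : SimpleGraph V} {A : Set V} {t1 t2 s1 s2 : V}
    (h : IsSideOf G {s1, s2} A) (hA1 : t1 ∈ A) (hA2 : t2 ∉ A) :
    ¬ HasK24XMinor G t1 t2 s1 s2 := by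
  rintro ⟨B, f, hf, hB, h0, h1, h2, h3⟩
  have havoid : ∀ x, x ≠ .inr (f 2) → x ≠ .inr (f 3) →
      ∀ v ∈ B x, v ∉ ({s1, s2} : Set V) := by
    rintro x hx2 hx3 v hv (rfl | rfl)
    · exact Set.disjoint_left.1 (hB.disjoint _ _ hx2) hv h2
    · exact Set.disjoint_left.1 (hB.disjoint _ _ hx3) hv h3
  have hne : ∀ i j, i ≠ j → (.inr (f i) : Fin 2 ⊕ Fin 4) ≠ .inr (f j) :=
    fun i j hij he => hij (hf (Sum.inr_injective he))
  have av0 := havoid (.inr (f 0)) (hne _ _ (by decide)) (hne _ _ (by decide))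
  have av1 := havoid (.inr (f 1)) (hne _ _ (by decide)) (hne _ _ (by decide))
  have avR := havoid (.inl 0) Sum.inl_ne_inr Sum.inl_ne_inr
  have spread : ∀ x, (∀ v ∈ B x, v ∉ ({s1, s2} : Set V)) →
      ∀ u ∈ B x, ∀ v ∈ B x, u ∈ A → v ∈ A := fun x hx u hu v hv =>
    of_connected_induce (hB.connected x) (P := (· ∈ A))
      (fun a ha b hb hab => h hab (hx a ha) (hx b hb)) hu hv
  obtain ⟨u, hu, u', hu', huu'⟩ := hB.adj_of_adj
    (show (completeBipartiteGraph (Fin 2) (Fin 4)).Adj (.inr (f 0)) (.inl 0) by simp)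
  obtain ⟨v, hv, v', hv', hvv'⟩ := hB.adj_of_adj
    (show (completeBipartiteGraph (Fin 2) (Fin 4)).Adj (.inl 0) (.inr (f 1)) by simp)
  have huA : u ∈ A := spread _ av0 _ h0 _ hu hA1
  have hu'A : u' ∈ A := h huu' (av0 _ hu) (avR _ hu') huA
  have hvA : v ∈ A := spread _ avR _ hu' _ hv hu'A
  have hv'A : v' ∈ A := h hvv' (avR _ hv) (av1 _ hv') hvA
  exact hA2 (spread _ av1 _ hv' _ h1 hv'A)

lemma not_mem_triangle_Hts {x y z : Fin 4} (hxy : Hts.Adj x y) (hxz : Hts.Adj x z)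
    (hyz : Hts.Adj y z) :
    ¬ ((0 : Fin 4) ∈ ({x, y, z} : Set (Fin 4)) ∧ (1 : Fin 4) ∈ ({x, y, z} : Set (Fin 4))) := by
  have h01 : ¬ Hts.Adj 0 1 := by simp [Hts]
  have h10 : ¬ Hts.Adj 1 0 := by simp [Hts]
  simp only [Set.mem_insert_iff, Set.mem_singleton_iff]
  have hxy' := hxy.symm
  have hxz' := hxz.symm
  have hyz' := hyz.symm
  grind

/-- In `H⁺`, the vertices `s1` and `s2` separate a set containing `t1` from `t2`. -/
lemma IsPlusOf.exists_isSideOf {Wb : SimpleGraph V} {g : Fin 4 ↪ V}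
    (hplus : IsPlusOf Wb Hts g) :
    ∃ A : Set V, IsSideOf Wb {g 2, g 3} A ∧ g 0 ∈ A ∧ g 1 ∉ A := by
  obtain ⟨t, htri, hH, hF, hFH⟩ := hplus
  have h01 : ∀ v, v ∉ Set.range g → ¬ (0 ∈ t v ∧ 1 ∈ t v) := by
    intro v hv
    obtain ⟨x, y, z, -, -, -, hxy, hxz, hyz, ht⟩ := htri v hv
    rw [ht]
    exact not_mem_triangle_Hts hxy hxz hyz
  have hi : ∀ i, g i ∉ ({g 2, g 3} : Set V) → i = 0 ∨ i = 1 := by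
    intro i hi
    fin_cases i
    · exact Or.inl rfl
    · exact Or.inr rfl
    · exact absurd (Or.inl rfl) hi
    · exact absurd (Or.inr rfl) hi
  refine ⟨{v | v = g 0 ∨ (v ∉ Set.range g ∧ 0 ∈ t v)}, ?_, Or.inl rfl, ?_⟩
  · rintro u v huv hu hv (rfl | ⟨hur, hu0⟩)
    · by_cases hvr : v ∈ Set.range g
      · obtain ⟨j, rfl⟩ := hvr
        rw [hH] at huv
        rcases hi j hv with rfl | rfl
        · exact Or.inl rfl
        · simp [Hts] at huv
      · exact Or.inr ⟨hvr, (hFH v hvr 0).1 huv.symm⟩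
    · by_cases hvr : v ∈ Set.range g
      · obtain ⟨j, rfl⟩ := hvr
        rcases hi j hv with rfl | rfl
        · exact Or.inl rfl
        · exact absurd ⟨hu0, (hFH u hur 1).1 huv⟩ (h01 u hur)
      · exact Or.inr ⟨hvr, ((hF u v hur hvr).1 huv).2 ▸ hu0⟩
  · rintro (h | ⟨h, -⟩)
    · exact absurd (g.injective h) (by decide)
    · exact h ⟨1, rfl⟩

/-- Let `G` be a 2-connected spanning subgraph of `H⁺`, where `H` has
vertices `t1,t2,s1,s2` and edges `t1s1, t1s2, t2s1, t2s2, s1s2`.  Then (i) `G` has a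
`K₂,₂`-model with `t1,t2` in the branch sets of one side and `s1,s2` in those of the
other side, and (ii) `G` has no `K₂,₄(X)`-minor for `X = {t1,t2,s1,s2}`. -/
theorem Hts_plus_K22_no_K24
    {V : Type*} [Fintype V] (G Wb : SimpleGraph V) (hG2 : KConnected G 2)
    (t1 t2 s1 s2 : V) (g : Fin 4 ↪ V)
    (hg0 : g 0 = t1) (hg1 : g 1 = t2) (hg2 : g 2 = s1) (hg3 : g 3 = s2)
    (hplus : IsPlusOf Wb Hts g) (hspan : G ≤ Wb) :
    HasK22TSMinor G t1 t2 s1 s2 ∧ ¬ HasK24XMinor G t1 t2 s1 s2 := by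
  subst hg0 hg1 hg2 hg3
  obtain ⟨A, hA, h0, h1⟩ := hplus.exists_isSideOf
  have hGA : IsSideOf G {g 2, g 3} A := fun u v huv => hA (hspan huv)
  have hconn : ∀ s, (G.induce ({s} : Set V)ᶜ).Connected := fun s => hG2.2 {s} (by simp)
  exact ⟨hGA.hasK22TSMinor (by simp) hconn (by simp) (by simp) h0 h1,
    hGA.not_hasK24XMinor h0 h1⟩

end Paper
end

section
/- Let G be a graph with a 2-separation (A,B) whose vertex boundary is A ∩ B = {x,y}, and let X = {a,b,c,d} ⊆ V(G) be four distinct vertices. If x, y ∈ X and of the two remaining vertices of X, one lies in A \ {x,y} and the other lies in B \ {x,y}, then G has no L(X)-minor. -/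
namespace Paper

open SimpleGraph

variable {V : Type*} {U : Type*}

/-- The graph `L`, with `v1, ..., v8` represented by `0, ..., 7`. -/
def Lgraph : SimpleGraph (Fin 8) := SimpleGraph.fromRel (fun i j =>
  (i, j) ∈ ([(0, 1), (0, 4), (1, 6), (1, 7), (1, 2), (2, 3), (3, 4), (3, 6), (4, 5),
             (5, 6), (5, 7), (6, 7)] : List (Fin 8 × Fin 8)))

/-- `G` has an `L(X)`-minor for `X = {a,b,c,d}`: an `L`-model of `G` in which the four
roots lie in four distinct branch sets among those of `v1, v3, v4, v5`
(i.e. `0, 2, 3, 4`). -/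
def HasLXMinor (G : SimpleGraph V) (a b c d : V) : Prop :=
  ∃ (B : Fin 8 → Set V) (f : Fin 4 → Fin 8), Function.Injective f ∧
    (∀ i, f i ∈ ({0, 2, 3, 4} : Set (Fin 8))) ∧
    IsModel G Lgraph B ∧
    a ∈ B (f 0) ∧ b ∈ B (f 1) ∧ c ∈ B (f 2) ∧ d ∈ B (f 3)

/-- A connected set avoiding the boundary of a separation lies on one side of it. -/
theorem IsSeparation.subset_left_of_mem {G : SimpleGraph V} {A B S : Set V}
    (hsep : IsSeparation G A B) (hS : (G.induce S).Connected) (hdisj : Disjoint S (A ∩ B))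
    {u v : V} (hu : u ∈ S) (hv : v ∈ S) (huA : u ∈ A) : v ∈ A := by
  obtain ⟨w⟩ := hS.preconnected ⟨u, hu⟩ ⟨v, hv⟩
  have key : ∀ s t : S, (G.induce S).Walk s t → (s : V) ∈ A → (t : V) ∈ A := by
    intro s t w
    induction w with
    | nil => exact id
    | @cons s m t hadj _ ih =>
      intro hs
      apply ih
      by_contra hm
      have hmB : (m : V) ∈ B :=
        ((hsep.1.symm ▸ Set.mem_univ (m : V) : (m : V) ∈ A ∪ B)).resolve_left hm
      have hsB : (s : V) ∉ B := fun hb => Set.disjoint_left.mp hdisj s.2 ⟨hs, hb⟩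
      exact hsep.2 s m ⟨hs, hsB⟩ ⟨hmB, hm⟩ hadj
  exact key _ _ w huA

/-- Any two of the vertices `0, 2, 3, 4` of `Lgraph` are joined by a path avoiding the other two,
stated as propagation of a property along edges avoiding them. -/
theorem Lgraph_propagate {i j k l : Fin 8}
    (hi : i ∈ ({0, 2, 3, 4} : Set (Fin 8))) (hj : j ∈ ({0, 2, 3, 4} : Set (Fin 8)))
    (hk : k ∈ ({0, 2, 3, 4} : Set (Fin 8))) (hl : l ∈ ({0, 2, 3, 4} : Set (Fin 8)))
    (hij : i ≠ j) (hik : i ≠ k) (hil : i ≠ l) (hjk : j ≠ k) (hjl : j ≠ l) (hkl : k ≠ l)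
    (P : Fin 8 → Prop)
    (hP : ∀ m n, Lgraph.Adj m n → m ≠ i → m ≠ j → n ≠ i → n ≠ j → P m → P n)
    (h : P k) : P l := by
  have step : ∀ m n, Lgraph.Adj m n → m ≠ i → m ≠ j → n ≠ i → n ≠ j → (P m ↔ P n) :=
    fun m n hmn h1 h2 h3 h4 => ⟨hP m n hmn h1 h2 h3 h4, hP n m hmn.symm h3 h4 h1 h2⟩
  have e01 := step 0 1 (by simp [Lgraph])
  have e04 := step 0 4 (by simp [Lgraph])
  have e16 := step 1 6 (by simp [Lgraph])
  have e12 := step 1 2 (by simp [Lgraph])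
  have e23 := step 2 3 (by simp [Lgraph])
  have e34 := step 3 4 (by simp [Lgraph])
  have e36 := step 3 6 (by simp [Lgraph])
  have e45 := step 4 5 (by simp [Lgraph])
  have e56 := step 5 6 (by simp [Lgraph])
  clear step hP
  simp only [Set.mem_insert_iff, Set.mem_singleton_iff] at hi hj hk hl
  rcases hi with rfl | rfl | rfl | rfl <;> rcases hj with rfl | rfl | rfl | rfl <;>
    first
    | exact absurd rfl hij
    | (rcases hk with rfl | rfl | rfl | rfl <;>
        first
        | exact absurd rfl hik
        | exact absurd rfl hjk
        | (rcases hl with rfl | rfl | rfl | rfl <;>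
            first
            | exact absurd rfl hil
            | exact absurd rfl hjl
            | exact absurd rfl hkl
            | (simp at e01 e04 e16 e12 e23 e34 e36 e45 e56
               tauto)))

/-- Let `G` be a graph with a 2-separation `(A,B)` with vertex
boundary `A ∩ B = {x,y}`, and let `X = {a,b,c,d}` be four distinct vertices of `G`.
If `x, y ∈ X` and, of the two remaining vertices of `X`, one lies in `A \ {x,y}` and
the other lies in `B \ {x,y}`, then `G` has no `L(X)`-minor. -/
theorem two_sep_cut_roots_no_LX_minor
    {V : Type*} [Fintype V] (G : SimpleGraph V)
    (A B : Set V) (x y : V) (hxy : x ≠ y)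
    (hsep : IsSeparation G A B) (hAB : A ∩ B = {x, y})
    (a b c d : V) (hab : a ≠ b) (hac : a ≠ c) (had : a ≠ d) (hbc : b ≠ c) (hbd : b ≠ d)
    (hcd : c ≠ d)
    (hxX : x ∈ ({a, b, c, d} : Set V)) (hyX : y ∈ ({a, b, c, d} : Set V))
    (hA : ∃ p ∈ ({a, b, c, d} : Set V) \ {x, y}, p ∈ A \ {x, y})
    (hB : ∃ q ∈ ({a, b, c, d} : Set V) \ {x, y}, q ∈ B \ {x, y}) :
    ¬ HasLXMinor G a b c d := by
  rintro ⟨M, f, hf, hfr, hM, ha, hb, hc, hd⟩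
  obtain ⟨p, ⟨hpX, hpxy⟩, hpA, -⟩ := hA
  obtain ⟨q, ⟨hqX, hqxy⟩, hqB, -⟩ := hB
  have hqA : q ∉ A := fun h => hqxy (hAB ▸ ⟨h, hqB⟩)
  have hroot : ∀ z ∈ ({a, b, c, d} : Set V), ∃ t, z = ![a, b, c, d] t ∧ z ∈ M (f t) := by
    rintro z (rfl | rfl | rfl | rfl)
    exacts [⟨0, rfl, ha⟩, ⟨1, rfl, hb⟩, ⟨2, rfl, hc⟩, ⟨3, rfl, hd⟩]
  obtain ⟨i, hxi, hxM⟩ := hroot x hxX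
  obtain ⟨j, hyj, hyM⟩ := hroot y hyX
  obtain ⟨k, hpk, hpM⟩ := hroot p hpX
  obtain ⟨l, hql, hqM⟩ := hroot q hqX
  simp only [Set.mem_insert_iff, Set.mem_singleton_iff, not_or] at hpxy hqxy
  have hne : ∀ {z w : V} {s t : Fin 4}, z = ![a, b, c, d] s → w = ![a, b, c, d] t → z ≠ w →
      f s ≠ f t := fun hz hw hzw hst => hzw (by rw [hz, hw, hf hst])
  have hside : ∀ m, m ≠ f i → m ≠ f j → ∀ u ∈ M m, ∀ v ∈ M m, u ∈ A → v ∈ A := by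
    intro m hmi hmj u hu v hv
    refine hsep.subset_left_of_mem (hM.connected m) ?_ hu hv
    rw [hAB, Set.disjoint_left]
    rintro z hz (rfl | rfl)
    · exact Set.disjoint_left.mp (hM.disjoint _ _ hmi) hz hxM
    · exact Set.disjoint_left.mp (hM.disjoint _ _ hmj) hz hyM
  have hnot : ∀ m, m ≠ f i → m ≠ f j → ∀ u ∈ M m, u ∈ A → u ∉ B := by
    intro m hmi hmj u hu huA huB
    have hmem : u ∈ ({x, y} : Set V) := hAB ▸ ⟨huA, huB⟩
    rcases hmem with rfl | rfl
    · exact Set.disjoint_left.mp (hM.disjoint _ _ hmi) hu hxM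
    · exact Set.disjoint_left.mp (hM.disjoint _ _ hmj) hu hyM
  have hki := hne hxi hpk (Ne.symm hpxy.1)
  have hkj := hne hyj hpk (Ne.symm hpxy.2)
  refine hqA (Lgraph_propagate (hfr i) (hfr j) (hfr k) (hfr l) (hne hxi hyj hxy) hki
    (hne hxi hql (Ne.symm hqxy.1)) hkj (hne hyj hql (Ne.symm hqxy.2))
    (hne hpk hql (fun h => hqA (h ▸ hpA))) (fun m => ∀ u ∈ M m, u ∈ A) ?_
    (fun u hu => hside _ hki.symm hkj.symm p hpM u hu hpA) q hqM)
  intro m n hmn hmi hmj hni hnj hmA v hv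
  obtain ⟨s, hs, t, ht, hst⟩ := hM.adj_of_adj hmn
  have htA : t ∈ A := by
    by_contra htA
    have htB : t ∈ B := ((hsep.1.symm ▸ Set.mem_univ t : t ∈ A ∪ B)).resolve_left htA
    exact hsep.2 s t ⟨hmA s hs, hnot m hmi hmj s hs (hmA s hs)⟩ ⟨htB, htA⟩ hst
  exact hside n hni hnj t ht v hv htA

end Paper
end
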